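/- The Rosenthal number ros is equal to the reaping number 𝔯. -/

import Mathlib

/-- A *Rosenthal matrix* is a matrix `M = (m_{k,n})` of non-negative reals whose rows are
summable and such that `‖M‖_∞ = sup_k Σ_n m_{k,n}` is finite. -/
def IsRosenthalMatrix (M : ℕ → ℕ → ℝ) : Prop :=
  (∀ k n, 0 ≤ M k n) ∧ (∀ k, Summable (M k)) ∧
    BddAbove (Set.range fun k => ∑' n, M k n)

/-- `M` is `ε`-fragmented by `A`: for every `k ∈ A`, `Σ_{n ∈ A \ {k}} m_{k,n} ≤ ε`. -/
def Fragments (M : ℕ → ℕ → ℝ) (ε : ℝ) (A : Set ℕ) : Prop :=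
  ∀ k ∈ A, ∑' n : (A \ {k} : Set ℕ), M k ↑n ≤ ε

/-- A *Rosenthal family*: a family of infinite subsets of `ℕ` such that every Rosenthal
matrix is `ε`-fragmented by some member of the family, for every `ε > 0`. -/
def IsRosenthalFamily (F : Set (Set ℕ)) : Prop :=
  (∀ A ∈ F, A.Infinite) ∧
    ∀ M : ℕ → ℕ → ℝ, IsRosenthalMatrix M → ∀ ε : ℝ, 0 < ε → ∃ A ∈ F, Fragments M ε A

/-- The Rosenthal number `ros`: the minimal cardinality of a Rosenthal family. -/
noncomputable def rosenthalNumber : Cardinal :=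
  sInf {c | ∃ F : Set (Set ℕ), IsRosenthalFamily F ∧ Cardinal.mk F = c}

/-- The reaping number `𝔯`: the minimal cardinality of a family `F` of infinite subsets of
`ℕ` such that no single `X ⊆ ℕ` splits all members of `F` (i.e. there is no `X` with both
`A ∩ X` and `A \ X` infinite for all `A ∈ F`). -/
noncomputable def reapingNumber : Cardinal :=
  sInf {c | ∃ F : Set (Set ℕ), (∀ A ∈ F, A.Infinite) ∧
    (¬ ∃ X : Set ℕ, ∀ A ∈ F, (A ∩ X).Infinite ∧ (A \ X).Infinite) ∧ Cardinal.mk F = c}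

open Filter Topology ENNReal

/-- A substochastic matrix admits a strictly positive summable weight which the matrix
at most doubles. -/
theorem exists_subinvariant_weight (a : ℕ → ℕ → ℝ≥0∞) (ha : ∀ k, ∑' n, a k n ≤ 1) :
    ∃ w : ℕ → ℝ≥0∞, (∀ k, w k ≠ 0) ∧ ∑' k, w k ≠ ⊤ ∧
      ∀ n, ∑' k, w k * a k n ≤ 2 * w n := by
  let v : ℕ → ℕ → ℝ≥0∞ := fun j =>
    Nat.rec (fun k => 2⁻¹ ^ k) (fun _ u n => 2⁻¹ * ∑' k, u k * a k n) j
  have v_zero : ∀ k, v 0 k = 2⁻¹ ^ k := fun _ => rfl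
  have v_succ : ∀ j n, v (j + 1) n = 2⁻¹ * ∑' k, v j k * a k n := fun _ _ => rfl
  have geom : ∑' k : ℕ, (2⁻¹ : ℝ≥0∞) ^ k = 2 := by
    rw [ENNReal.tsum_geometric, ENNReal.one_sub_inv_two, inv_inv]
  have v_sum : ∀ j, ∑' n, v j n ≤ 2 * 2⁻¹ ^ j := by
    intro j
    induction j with
    | zero => simp [v_zero, geom]
    | succ j ih =>
      calc ∑' n, v (j + 1) n = 2⁻¹ * ∑' k, v j k * ∑' n, a k n := by
            simp_rw [v_succ, ENNReal.tsum_mul_left]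
            rw [ENNReal.tsum_comm]
            simp_rw [ENNReal.tsum_mul_left]
        _ ≤ 2⁻¹ * ∑' k, v j k * 1 := by
            gcongr with k
            exact ha k
        _ ≤ 2⁻¹ * (2 * 2⁻¹ ^ j) := by simpa using by gcongr
        _ = 2 * 2⁻¹ ^ (j + 1) := by ring
  refine ⟨fun n => ∑' j, v j n, fun k hk => ?_, ?_, fun n => ?_⟩
  · have h := (ENNReal.tsum_eq_zero.1 hk) 0
    simp [v_zero] at h
  · refine ne_top_of_le_ne_top (b := 4) (by simp) ?_
    rw [ENNReal.tsum_comm]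
    calc ∑' j, ∑' n, v j n ≤ ∑' j : ℕ, 2 * 2⁻¹ ^ j := ENNReal.tsum_le_tsum v_sum
      _ = 4 := by rw [ENNReal.tsum_mul_left, geom]; norm_num
  · calc ∑' k, (∑' j, v j k) * a k n = ∑' j, ∑' k, v j k * a k n := by
          simp_rw [← ENNReal.tsum_mul_right]
          exact ENNReal.tsum_comm
      _ = 2 * ∑' j, v (j + 1) n := by
          simp_rw [v_succ, ENNReal.tsum_mul_left, ← mul_assoc]
          rw [ENNReal.mul_inv_cancel (by simp) (by simp), one_mul]
      _ ≤ 2 * ∑' j, v j n := by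
          exact mul_le_mul_right (ENNReal.tsum_comp_le_tsum_of_injective
            (add_left_injective 1) fun j => v j n) 2

/-- Total weight of the pairs on which the colouring `d` is monochromatic. -/
noncomputable def monoEnergy {N : ℕ} (g : ℕ → ℕ → ℝ≥0∞) (d : ℕ → Fin N) : ℝ≥0∞ :=
  ∑' x, ∑' y, if d x = d y then g x y else 0

theorem lowerSemicontinuous_monoEnergy {N : ℕ} (g : ℕ → ℕ → ℝ≥0∞) :
    LowerSemicontinuous (monoEnergy g : (ℕ → Fin N) → ℝ≥0∞) := by
  refine lowerSemicontinuous_tsum fun x => lowerSemicontinuous_tsum fun y => ?_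
  refine Continuous.lowerSemicontinuous ?_
  have h : Continuous fun d : ℕ → Fin N => (d x, d y) := by fun_prop
  exact (continuous_of_discreteTopology
    (f := fun p : Fin N × Fin N => if p.1 = p.2 then g x y else 0)).comp h

/-- The energy after recolouring `k` with `j`, split into the part not involving `k` and the rest. -/
theorem monoEnergy_update {N : ℕ} (g : ℕ → ℕ → ℝ≥0∞) (hg : ∀ x, g x x = 0) (d : ℕ → Fin N)
    (k : ℕ) (j : Fin N) :
    monoEnergy g (Function.update d k j) =
      (∑' x, ∑' y, if x ≠ k ∧ y ≠ k ∧ d x = d y then g x y else 0) +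
        ∑' n, if d n = j then g k n + g n k else 0 := by
  have split : ∀ x y, (if Function.update d k j x = Function.update d k j y then g x y else 0) =
      (if x ≠ k ∧ y ≠ k ∧ d x = d y then g x y else 0) +
        ((if x = k then if d y = j then g k y else 0 else 0) +
          (if y = k then if d x = j then g x k else 0 else 0)) := by
    intro x y
    by_cases hx : x = k <;> by_cases hy : y = k
    · subst hx; subst hy; simp [hg]
    · subst hx; simp [hy, eq_comm]
    · subst hy; simp [hx]
    · simp [hx, hy]
  have merge : ∀ n, (if d n = j then g k n + g n k else 0) =
      (if d n = j then g k n else 0) + (if d n = j then g n k else 0) := by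
    intro n; split_ifs <;> simp
  simp_rw [monoEnergy, split, merge, ENNReal.tsum_add, tsum_ite_eq]
  congr 2
  rw [ENNReal.tsum_comm]
  simp_rw [tsum_ite_eq]

/-- Paving: a substochastic matrix with zero diagonal has an `N`-colouring for which every row
has mass at most `3 / N` on its own colour class. -/
theorem exists_paving (a : ℕ → ℕ → ℝ≥0∞) (hd : ∀ k, a k k = 0) (ha : ∀ k, ∑' n, a k n ≤ 1)
    (N : ℕ) [NeZero N] :
    ∃ c : ℕ → Fin N, ∀ k, N * ∑' n, (if c n = c k then a k n else 0) ≤ 3 := by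
  obtain ⟨w, w_pos, w_sum, w_inv⟩ := exists_subinvariant_weight a ha
  have w_top : ∀ k, w k ≠ ⊤ := fun k => ne_top_of_le_ne_top w_sum (ENNReal.le_tsum k)
  let g : ℕ → ℕ → ℝ≥0∞ := fun x y => w x * a x y
  have hg : ∀ x, g x x = 0 := fun x => by simp [g, hd]
  have energy_top : ∀ d : ℕ → Fin N, monoEnergy g d ≠ ⊤ := by
    intro d
    refine ne_top_of_le_ne_top w_sum (ENNReal.tsum_le_tsum fun x => ?_)
    calc (∑' y, if d x = d y then g x y else 0) ≤ ∑' y, w x * a x y :=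
          ENNReal.tsum_le_tsum fun y => by split_ifs <;> simp [g]
      _ ≤ w x := by
          rw [ENNReal.tsum_mul_left]
          exact mul_le_of_le_one_right' (ha x)
  obtain ⟨c, -, hc⟩ := LowerSemicontinuousOn.exists_isMinOn (s := Set.univ) Set.univ_nonempty
    isCompact_univ ((lowerSemicontinuous_monoEnergy (N := N) g).lowerSemicontinuousOn _)
  refine ⟨c, fun k => ?_⟩
  let S : Fin N → ℝ≥0∞ := fun j => ∑' n, if c n = j then g k n + g n k else 0
  have S_min : ∀ j, S (c k) ≤ S j := by
    intro j
    have h : monoEnergy g (Function.update c k (c k)) ≤ monoEnergy g (Function.update c k j) := by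
      rw [Function.update_eq_self]
      exact hc (Set.mem_univ _)
    have htop := energy_top (Function.update c k j)
    rw [monoEnergy_update g hg] at htop
    rw [monoEnergy_update g hg, monoEnergy_update g hg] at h
    exact ENNReal.le_of_add_le_add_left (ne_top_of_le_ne_top htop le_self_add) h
  have S_total : ∑ j, S j ≤ w k * 3 := by
    calc ∑ j, S j = ∑' n, (g k n + g n k) := by
          rw [← Summable.tsum_finsetSum fun _ _ => ENNReal.summable]
          simp
      _ ≤ w k * 1 + 2 * w k := by
          rw [ENNReal.tsum_add]
          refine add_le_add ?_ (w_inv k)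
          simp only [g, ENNReal.tsum_mul_left]
          gcongr
          exact ha k
      _ = w k * 3 := by ring
  rw [← ENNReal.mul_le_mul_iff_right (w_pos k) (w_top k)]
  calc w k * (N * ∑' n, if c n = c k then a k n else 0)
      = N * ∑' n, (if c n = c k then g k n else 0) := by
        rw [mul_left_comm, ← ENNReal.tsum_mul_left]
        simp [g]
    _ ≤ N * S (c k) := by
        gcongr
        refine ENNReal.tsum_le_tsum fun n => ?_
        split_ifs <;> simp
    _ = ∑ _j : Fin N, S (c k) := by simp
    _ ≤ ∑ j, S j := Finset.sum_le_sum fun j _ => S_min j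
    _ ≤ w k * 3 := S_total

/-- Every Rosenthal matrix has a finite colouring all of whose monochromatic sets fragment it. -/
theorem IsRosenthalMatrix.exists_coloring {M : ℕ → ℕ → ℝ} (hM : IsRosenthalMatrix M) {ε : ℝ}
    (hε : 0 < ε) :
    ∃ (N : ℕ) (c : ℕ → Fin N), ∀ A : Set ℕ, (∀ x ∈ A, ∀ y ∈ A, c x = c y) →
      Fragments M ε A := by
  obtain ⟨M_nonneg, M_summable, B₀, hB₀⟩ := hM
  obtain ⟨B, B_pos, hB⟩ : ∃ B : ℝ, 0 < B ∧ ∀ k, ∑' n, M k n ≤ B :=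
    ⟨max B₀ 1, by positivity, fun k => (hB₀ ⟨k, rfl⟩).trans (le_max_left _ _)⟩
  obtain ⟨N₀, hN₀⟩ := exists_nat_gt (3 * B / ε)
  let N := N₀ + 1
  have hN : 3 * B ≤ N * ε := by
    rw [div_lt_iff₀ hε] at hN₀
    simp only [N]
    push_cast
    linarith
  let a : ℕ → ℕ → ℝ≥0∞ := fun k n => if n = k then 0 else ENNReal.ofReal (M k n / B)
  obtain ⟨c, hc⟩ := exists_paving a (by simp [a])
    (fun k => by
      calc ∑' n, a k n ≤ ∑' n, ENNReal.ofReal (M k n / B) :=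
            ENNReal.tsum_le_tsum fun n => by simp only [a]; split_ifs <;> simp
        _ = ENNReal.ofReal (∑' n, M k n / B) :=
            (ENNReal.ofReal_tsum_of_nonneg (fun n => div_nonneg (M_nonneg k n) B_pos.le)
              ((M_summable k).div_const B)).symm
        _ ≤ 1 := by
            rw [tsum_div_const, ENNReal.ofReal_le_one]
            exact (div_le_one B_pos).2 (hB k)) N
  refine ⟨N, c, fun A hA k hk => ?_⟩
  have sub_summable : Summable fun n : (A \ {k} : Set ℕ) => M k n :=
    (M_summable k).subtype _
  have key : ENNReal.ofReal (∑' n : (A \ {k} : Set ℕ), M k n / B) ≤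
      ∑' n, if c n = c k then a k n else 0 := by
    rw [ENNReal.ofReal_tsum_of_nonneg
      (f := fun n : (A \ {k} : Set ℕ) => M k n / B)
      (fun n => div_nonneg (M_nonneg k n) B_pos.le) (sub_summable.div_const B)]
    rw [tsum_subtype (A \ {k}) fun n => ENNReal.ofReal (M k n / B)]
    refine ENNReal.tsum_le_tsum fun n => ?_
    by_cases hn : n ∈ A \ {k}
    · have hnk : n ≠ k := hn.2
      simp [Set.indicator_of_mem hn, hA n hn.1 k hk, a, hnk]
    · simp [Set.indicator_of_notMem hn]
  have bound : ENNReal.ofReal (N * ∑' n : (A \ {k} : Set ℕ), M k n / B) ≤ ENNReal.ofReal 3 := by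
    rw [ENNReal.ofReal_mul (by positivity), ENNReal.ofReal_natCast]
    calc _ ≤ (N : ℝ≥0∞) * ∑' n, (if c n = c k then a k n else 0) := by gcongr
      _ ≤ 3 := hc k
      _ = _ := by simp
  rw [ENNReal.ofReal_le_ofReal_iff (by norm_num), tsum_div_const, mul_div_assoc',
    div_le_iff₀ B_pos] at bound
  exact le_of_mul_le_mul_left (bound.trans hN) (by positivity)

/-- No set splits all members of `F`. -/
def IsUnsplit (F : Set (Set ℕ)) : Prop :=
  ¬ ∃ X : Set ℕ, ∀ A ∈ F, (A ∩ X).Infinite ∧ (A \ X).Infinite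

theorem not_isUnsplit_of_countable {F : Set (Set ℕ)} (hF : ∀ A ∈ F, A.Infinite)
    (hc : F.Countable) : ¬ IsUnsplit F := by
  rw [IsUnsplit, not_not]
  rcases F.eq_empty_or_nonempty with rfl | hne
  · exact ⟨∅, by simp⟩
  obtain ⟨A, rfl⟩ := hc.exists_eq_range hne
  obtain ⟨φ, φ_mono, hφ⟩ := extraction_forall_of_frequently
    (P := fun n k => k ∈ A (Nat.unpair (n / 2)).1)
    fun n => Nat.frequently_atTop_iff_infinite.2 (hF _ ⟨_, rfl⟩)
  refine ⟨φ '' {n | Even n}, ?_⟩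
  rintro _ ⟨i, rfl⟩
  constructor
  · refine Set.infinite_of_injective_forall_mem (f := fun m => φ (2 * Nat.pair i m))
      (fun m m' h => ?_) fun m => ⟨?_, _, by simp, rfl⟩
    · simpa using φ_mono.injective h
    · simpa using hφ (2 * Nat.pair i m)
  · refine Set.infinite_of_injective_forall_mem (f := fun m => φ (2 * Nat.pair i m + 1))
      (fun m m' h => ?_) fun m => ⟨?_, ?_⟩
    · simpa using φ_mono.injective h
    · have h2 : (2 * Nat.pair i m + 1) / 2 = Nat.pair i m := by omega
      simpa [h2] using hφ (2 * Nat.pair i m + 1)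
    · rintro ⟨n, hn, h⟩
      rw [φ_mono.injective h] at hn
      simp at hn

/-- Composition of the maps `e A` along a list. -/
def composeAlong {α : Type*} (e : α → ℕ → ℕ) : List α → ℕ → ℕ
  | [] => id
  | A :: l => e A ∘ composeAlong e l

theorem composeAlong_strictMono {α : Type*} {e : α → ℕ → ℕ} (he : ∀ A, StrictMono (e A)) :
    ∀ l, StrictMono (composeAlong e l)
  | [] => strictMono_id
  | A :: l => (he A).comp (composeAlong_strictMono he l)

/-- If the enumerations `e A` enumerate subsets of the members of an unsplit family, every finite
colouring is eventually constant along some composition of them. -/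
theorem IsUnsplit.exists_eventually_const {F : Set (Set ℕ)} (hF : IsUnsplit F)
    {e : F → ℕ → ℕ} (he : ∀ A, StrictMono (e A)) (hmem : ∀ A n, e A n ∈ A.1) (N : ℕ) :
    ∀ c : ℕ → ℕ, (∀ᶠ n in atTop, c n < N) →
      ∃ l i, ∀ᶠ n in atTop, c (composeAlong e l n) = i := by
  induction N with
  | zero => intro c hc; obtain ⟨n, hn⟩ := hc.exists; omega
  | succ N ih =>
    intro c hc
    have avoid : ∀ (A : F) (Y : Set ℕ), (A.1 ∩ Y).Finite → ∀ᶠ n in atTop, e A n ∉ Y := by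
      intro A Y hY
      have h := (he A).injective.tendsto_cofinite.eventually hY.eventually_cofinite_notMem
      rw [Nat.cofinite_eq_atTop] at h
      filter_upwards [h] with n hn hn'
      exact hn ⟨hmem A n, hn'⟩
    simp only [IsUnsplit, not_exists, not_forall, not_and_or, Set.not_infinite] at hF
    obtain ⟨A, hA, h | h⟩ := hF {n | c n = N}
    · obtain ⟨l, i, hl⟩ := ih (c ∘ e ⟨A, hA⟩) (by
        filter_upwards [avoid ⟨A, hA⟩ _ h, (he ⟨A, hA⟩).tendsto_atTop.eventually hc] with n h1 h2
        exact lt_of_le_of_ne (Nat.lt_succ_iff.1 h2) h1)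
      exact ⟨⟨A, hA⟩ :: l, i, hl⟩
    · refine ⟨[⟨A, hA⟩], N, ?_⟩
      filter_upwards [avoid ⟨A, hA⟩ {n | c n = N}ᶜ h] with n hn
      simpa [composeAlong] using hn

theorem IsUnsplit.exists_isRosenthalFamily {F : Set (Set ℕ)} (hF : ∀ A ∈ F, A.Infinite)
    (hu : IsUnsplit F) :
    ∃ G : Set (Set ℕ), IsRosenthalFamily G ∧ Cardinal.mk G ≤ Cardinal.mk F := by
  have enum : ∀ A : F, ∃ e : ℕ → ℕ, StrictMono e ∧ ∀ n, e n ∈ A.1 := fun A =>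
    extraction_of_frequently_atTop (Nat.frequently_atTop_iff_infinite.2 (hF A A.2))
  choose e he hmem using enum
  refine ⟨Set.range fun p : List F × ℕ => composeAlong e p.1 '' Set.Ici p.2, ⟨?_, ?_⟩, ?_⟩
  · rintro _ ⟨⟨l, m⟩, rfl⟩
    exact (Set.Ici_infinite m).image (composeAlong_strictMono he l).injective.injOn
  · intro M hM ε hε
    obtain ⟨N, c, hc⟩ := hM.exists_coloring hε
    obtain ⟨l, i, hl⟩ := hu.exists_eventually_const he hmem N (fun n => c n)
      (Eventually.of_forall fun n => (c n).isLt)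
    obtain ⟨m, hm⟩ := eventually_atTop.1 hl
    refine ⟨_, ⟨(l, m), rfl⟩, hc _ ?_⟩
    rintro _ ⟨x, hx, rfl⟩ _ ⟨y, hy, rfl⟩
    exact Fin.ext ((hm x hx).trans (hm y hy).symm)
  · have inf : Cardinal.aleph0 ≤ Cardinal.mk F := by
      by_contra! h
      exact not_isUnsplit_of_countable hF (Cardinal.le_aleph0_iff_set_countable.1 h.le) hu
    calc _ ≤ Cardinal.mk (List F × ℕ) := Cardinal.mk_range_le
      _ = Cardinal.mk (List F) * Cardinal.aleph0 := by simp
      _ ≤ Cardinal.mk F * Cardinal.mk F :=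
          mul_le_mul' ((Cardinal.mk_list_le_max F).trans (max_le inf le_rfl)) inf
      _ = Cardinal.mk F := Cardinal.mul_eq_self inf

theorem exists_split_of_lt_reapingNumber {F : Set (Set ℕ)} (hF : ∀ A ∈ F, A.Infinite)
    (hlt : Cardinal.mk F < reapingNumber) :
    ∃ X : Set ℕ, ∀ A ∈ F, (A ∩ X).Infinite ∧ (A \ X).Infinite := by
  by_contra h
  exact notMem_of_lt_csInf' hlt ⟨F, hF, h, rfl⟩

/-- A family smaller than the reaping number is split into infinitely many pieces at once. -/
theorem exists_infinite_fibers_of_lt_reapingNumber {F : Set (Set ℕ)} (hF : ∀ A ∈ F, A.Infinite)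
    (hlt : Cardinal.mk F < reapingNumber) :
    ∃ g : ℕ → ℕ, ∀ A ∈ F, ∀ n, {k ∈ A | g k = n}.Infinite := by
  have step : ∀ B : {B : Set ℕ // ∀ A ∈ F, (A ∩ B).Infinite},
      ∃ C : {B : Set ℕ // ∀ A ∈ F, (A ∩ B).Infinite},
        C.1 ⊆ B.1 ∧ ∀ A ∈ F, (A ∩ (B.1 \ C.1)).Infinite := by
    rintro ⟨B, hB⟩
    obtain ⟨X, hX⟩ := exists_split_of_lt_reapingNumber (F := (· ∩ B) '' F)
      (by rintro _ ⟨A, hA, rfl⟩; exact hB A hA) (Cardinal.mk_image_le.trans_lt hlt)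
    refine ⟨⟨B ∩ X, fun A hA => ?_⟩, Set.inter_subset_left, fun A hA => ?_⟩
    · simpa [Set.inter_assoc] using (hX _ ⟨A, hA, rfl⟩).1
    · simpa [Set.inter_sdiff_assoc] using (hX _ ⟨A, hA, rfl⟩).2
  choose next next_sub next_inf using step
  let B : ℕ → {B : Set ℕ // ∀ A ∈ F, (A ∩ B).Infinite} := fun n =>
    next^[n] ⟨Set.univ, fun A hA => by simpa using hF A hA⟩
  have B_succ : ∀ n, B (n + 1) = next (B n) := fun n => Function.iterate_succ_apply' _ _ _
  have B_anti : Antitone fun n => (B n).1 :=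
    antitone_nat_of_succ_le fun n => by rw [B_succ]; exact next_sub _
  refine ⟨fun k => sInf {n | k ∉ (B (n + 1)).1}, fun A hA n => ?_⟩
  refine (next_inf (B n) A hA).mono ?_
  rintro k ⟨hkA, hkB, hkC⟩
  rw [← B_succ] at hkC
  refine ⟨hkA, le_antisymm (Nat.sInf_le hkC) (le_csInf ⟨n, hkC⟩ fun m hm => ?_)⟩
  by_contra! hlt
  exact hm (B_anti (Nat.succ_le_of_lt hlt) hkB)

theorem IsRosenthalFamily.reapingNumber_le {F : Set (Set ℕ)} (hF : IsRosenthalFamily F) :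
    reapingNumber ≤ Cardinal.mk F := by
  by_contra! hlt
  obtain ⟨g, hg⟩ := exists_infinite_fibers_of_lt_reapingNumber hF.1 hlt
  let M : ℕ → ℕ → ℝ := fun k n => if n = g k then 1 else 0
  have hM : IsRosenthalMatrix M := by
    refine ⟨fun k n => ?_, fun k => (hasSum_ite_eq (g k) 1).summable, 1, ?_⟩
    · simp only [M]; split_ifs <;> simp
    · rintro _ ⟨k, rfl⟩
      simp [M]
  obtain ⟨A, hA, hfrag⟩ := hF.2 M hM (1 / 2) (by norm_num)
  obtain ⟨n, hn⟩ := (hF.1 A hA).nonempty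
  obtain ⟨k, ⟨hkA, hk⟩, hkn⟩ := (hg A hA n).exists_notMem_finite (Set.finite_singleton n)
  have hnk : n ∈ A \ {k} := ⟨hn, fun h => hkn h.symm⟩
  have le := ((hM.2.1 k).subtype (· ∈ A \ {k})).le_tsum ⟨n, hnk⟩ fun m _ => hM.1 k m
  have lt := hfrag k hkA
  have val : M k n = 1 := by simp [M, hk]
  simp only [Function.comp_apply, val] at le
  linarith

/-- The family of all infinite subsets of `ℕ` is unsplit. -/
theorem isUnsplit_setOf_infinite : IsUnsplit {A : Set ℕ | A.Infinite} := by
  rintro ⟨X, hX⟩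
  have h := (hX Set.univ Set.infinite_univ).1
  rw [Set.univ_inter] at h
  simpa using (hX X h).2

/-- The Rosenthal number `ros` equals the reaping number `𝔯`. -/
theorem rosenthal_eq_reaping : rosenthalNumber = reapingNumber := by
  have ros_le : ∀ F : Set (Set ℕ), (∀ A ∈ F, A.Infinite) → IsUnsplit F →
      rosenthalNumber ≤ Cardinal.mk F := fun F hF hu => by
    obtain ⟨G, hG, hle⟩ := hu.exists_isRosenthalFamily hF
    have h : rosenthalNumber ≤ Cardinal.mk G := csInf_le' ⟨G, hG, rfl⟩
    exact h.trans hle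
  apply le_antisymm
  · refine le_csInf ⟨Cardinal.mk {A : Set ℕ | A.Infinite}, {A | A.Infinite}, fun _ h => h, isUnsplit_setOf_infinite, rfl⟩ ?_
    rintro _ ⟨F, hF, hu, rfl⟩
    exact ros_le F hF hu
  · obtain ⟨G, hG, -⟩ := isUnsplit_setOf_infinite.exists_isRosenthalFamily fun _ h => h
    refine le_csInf ⟨Cardinal.mk G, G, hG, rfl⟩ ?_
    rintro _ ⟨F, hF, rfl⟩
    exact hF.reapingNumber_le
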